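/- Let A be a subalgebra of an algebra E, X an A-complement of E, and (A, X, ▷, ◁, ↼, ⇀) the associated canonical matched pair. Then the assignment r ↦ X_r induces a bijection between the quotient of the set of deformation maps of this matched pair by the equivalence relation ∼ and the set of algebra-isomorphism classes of A-complements of E; in particular, the number of isomorphism classes of A-complements of E equals the number of ∼-equivalence classes of deformation maps. -/

import Mathlib

/-- A matched pair of (associative, not necessarily unital) `K`-algebras
`(A, X, ▷, ◁, ↼, ⇀)`.  Here `tr x a = x ▷ a`, `tl x a = x ◁ a`,
`lh a x = a ↼ x` and `rh a x = a ⇀ x`. -/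
structure MatchedPair (K A X : Type*) [Field K]
    [NonUnitalRing A] [Module K A] [SMulCommClass K A A] [IsScalarTower K A A]
    [NonUnitalRing X] [Module K X] [SMulCommClass K X X] [IsScalarTower K X X] where
  tr : X →ₗ[K] A →ₗ[K] A
  tl : X →ₗ[K] A →ₗ[K] X
  lh : A →ₗ[K] X →ₗ[K] A
  rh : A →ₗ[K] X →ₗ[K] X
  /-- `(X, ⇀)` is a left `A`-module -/
  rh_mul : ∀ (a b : A) (x : X), rh (a * b) x = rh a (rh b x)
  /-- `(X, ◁)` is a right `A`-module -/
  tl_mul : ∀ (x : X) (a b : A), tl x (a * b) = tl (tl x a) b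
  /-- `(X, ⇀, ◁)` is an `A`-bimodule -/
  rh_tl : ∀ (a : A) (x : X) (b : A), tl (rh a x) b = rh a (tl x b)
  /-- `(A, ▷)` is a left `X`-module -/
  tr_mul : ∀ (x y : X) (a : A), tr (x * y) a = tr x (tr y a)
  /-- `(A, ↼)` is a right `X`-module -/
  lh_mul : ∀ (a : A) (x y : X), lh a (x * y) = lh (lh a x) y
  /-- `(A, ▷, ↼)` is an `X`-bimodule -/
  tr_lh : ∀ (x : X) (a : A) (y : X), lh (tr x a) y = tr x (lh a y)
  /-- (MP1) `a ⇀ (xy) = (a ⇀ x)y + (a ↼ x) ⇀ y` -/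
  mp1 : ∀ (a : A) (x y : X), rh a (x * y) = rh a x * y + rh (lh a x) y
  /-- (MP2) `(ab) ↼ x = a(b ↼ x) + a ↼ (b ⇀ x)` -/
  mp2 : ∀ (a b : A) (x : X), lh (a * b) x = a * lh b x + lh a (rh b x)
  /-- (MP3) `x ▷ (ab) = (x ▷ a)b + (x ◁ a) ▷ b` -/
  mp3 : ∀ (x : X) (a b : A), tr x (a * b) = tr x a * b + tr (tl x a) b
  /-- (MP4) `(xy) ◁ a = x ◁ (y ▷ a) + x(y ◁ a)` -/
  mp4 : ∀ (x y : X) (a : A), tl (x * y) a = tl x (tr y a) + x * tl y a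
  /-- (MP5) `a(x ▷ b) + a ↼ (x ◁ b) = (a ↼ x)b + (a ⇀ x) ▷ b` -/
  mp5 : ∀ (a : A) (x : X) (b : A), a * tr x b + lh a (tl x b) = lh a x * b + tr (rh a x) b
  /-- (MP6) `x ◁ (a ↼ y) + x(a ⇀ y) = (x ▷ a) ⇀ y + (x ◁ a)y` -/
  mp6 : ∀ (x : X) (a : A) (y : X), tl x (lh a y) + x * rh a y = rh (tr x a) y + tl x a * y

/-- The multiplication of the bicrossed product `A ⋈ X`:
`(a, x) • (b, y) = (ab + a ↼ y + x ▷ b, a ⇀ y + x ◁ b + xy)`. -/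
def bicrossedMul {K A X : Type*} [Field K]
    [NonUnitalRing A] [Module K A] [SMulCommClass K A A] [IsScalarTower K A A]
    [NonUnitalRing X] [Module K X] [SMulCommClass K X X] [IsScalarTower K X X]
    (mp : MatchedPair K A X) (p q : A × X) : A × X :=
  (p.1 * q.1 + mp.lh p.1 q.2 + mp.tr p.2 q.1,
    mp.rh p.1 q.2 + mp.tl p.2 q.1 + p.2 * q.2)

/-- `X` is an `A`-complement of `E`: `E = A + X` and `A ∩ X = {0}`. -/
def IsComplement {K E : Type*} [Field K]
    [NonUnitalRing E] [Module K E] [SMulCommClass K E E] [IsScalarTower K E E]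
    (A X : NonUnitalSubalgebra K E) : Prop :=
  (∀ e : E, ∃ a ∈ A, ∃ x ∈ X, e = a + x) ∧ (∀ e : E, e ∈ A → e ∈ X → e = 0)

/-- `mp` is the canonical matched pair associated with a factorization `E = A + X`:
its four maps are obtained by decomposing products in `E` as
`x a = x ▷ a + x ◁ a` and `a x = a ↼ x + a ⇀ x`. -/
def IsCanonicalMatchedPair {K E : Type*} [Field K]
    [NonUnitalRing E] [Module K E] [SMulCommClass K E E] [IsScalarTower K E E]
    (A X : NonUnitalSubalgebra K E) (mp : MatchedPair K A X) : Prop :=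
  ∀ (x : X) (a : A),
    (x : E) * (a : E) = (mp.tr x a : E) + (mp.tl x a : E) ∧
    (a : E) * (x : E) = (mp.lh a x : E) + (mp.rh a x : E)

/-- `r : X → A` is a deformation map of the matched pair `(A, X, ▷, ◁, ↼, ⇀)`:
`r(x)r(y) − r(xy) = r(r(x) ⇀ y + x ◁ r(y)) − r(x) ↼ y − x ▷ r(y)`. -/
def IsDeformationMap {K A X : Type*} [Field K]
    [NonUnitalRing A] [Module K A] [SMulCommClass K A A] [IsScalarTower K A A]
    [NonUnitalRing X] [Module K X] [SMulCommClass K X X] [IsScalarTower K X X]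
    (mp : MatchedPair K A X) (r : X →ₗ[K] A) : Prop :=
  ∀ x y : X, r x * r y - r (x * y) =
    r (mp.rh (r x) y + mp.tl x (r y)) - mp.lh (r x) y - mp.tr x (r y)

/-- The multiplication of the `r`-deformation `X_r` of `X`:
`x ·_r y = xy + r(x) ⇀ y + x ◁ r(y)`. -/
def deformedMul {K A X : Type*} [Field K]
    [NonUnitalRing A] [Module K A] [SMulCommClass K A A] [IsScalarTower K A A]
    [NonUnitalRing X] [Module K X] [SMulCommClass K X X] [IsScalarTower K X X]
    (mp : MatchedPair K A X) (r : X →ₗ[K] A) (x y : X) : X :=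
  x * y + mp.rh (r x) y + mp.tl x (r y)

/-- Two deformation maps `r, R : X → A` are equivalent (`r ∼ R`) if there is a linear
automorphism `σ` of `X` with
`σ(xy) − σ(x)σ(y) = σ(x) ◁ R(σ(y)) + R(σ(x)) ⇀ σ(y) − σ(x ◁ r(y)) − σ(r(x) ⇀ y)`
for all `x, y ∈ X`. -/
def DefMapEquiv {K A X : Type*} [Field K]
    [NonUnitalRing A] [Module K A] [SMulCommClass K A A] [IsScalarTower K A A]
    [NonUnitalRing X] [Module K X] [SMulCommClass K X X] [IsScalarTower K X X]
    (mp : MatchedPair K A X) (r R : X →ₗ[K] A) : Prop :=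
  ∃ σ : X ≃ₗ[K] X, ∀ x y : X,
    σ (x * y) - σ x * σ y =
      mp.tl (σ x) (R (σ y)) + mp.rh (R (σ x)) (σ y)
        - σ (mp.tl x (r y)) - σ (mp.rh (r x) y)

section Complements

variable {K E : Type*} [Field K]
  [NonUnitalRing E] [Module K E] [SMulCommClass K E E] [IsScalarTower K E E]
  {A X : NonUnitalSubalgebra K E} {mp : MatchedPair K A X}

theorem IsComplement.add_inj (h : IsComplement A X) {a b : A} {x y : X}
    (hab : (a : E) + x = b + y) : a = b ∧ x = y := by
  have hsub : (a : E) - b = y - x := by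
    rw [sub_eq_sub_iff_add_eq_add, hab, add_comm]
  have h0 : (a : E) - b = 0 :=
    h.2 _ (sub_mem a.2 b.2) (hsub ▸ sub_mem y.2 x.2)
  refine ⟨Subtype.ext (sub_eq_zero.1 h0), Subtype.ext (sub_eq_zero.1 (hsub ▸ h0 :)).symm⟩

/-- The product of two elements of the graph of a linear map `r : X → A`. -/
theorem IsCanonicalMatchedPair.graph_mul (hmp : IsCanonicalMatchedPair A X mp)
    (r : X →ₗ[K] A) (x y : X) :
    ((r x : E) + x) * (r y + y) =
      ((r x * r y + mp.lh (r x) y + mp.tr x (r y) : A) : E) + (deformedMul mp r x y : X) := by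
  simp only [add_mul, mul_add, (hmp _ _).1, (hmp _ _).2, deformedMul,
    NonUnitalSubalgebra.coe_add, NonUnitalSubalgebra.coe_mul]
  abel

theorem isDeformationMap_iff (r : X →ₗ[K] A) :
    IsDeformationMap mp r ↔ ∀ x y : X,
      r x * r y + mp.lh (r x) y + mp.tr x (r y) = r (deformedMul mp r x y) := by
  refine forall₂_congr fun x y => ?_
  simp only [deformedMul, map_add]
  rw [← sub_eq_zero, ← sub_eq_zero (b := r (x * y) + _ + _)]
  refine Eq.congr ?_ rfl
  abel

theorem defMapEquiv_iff (r R : X →ₗ[K] A) :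
    DefMapEquiv mp r R ↔ ∃ σ : X ≃ₗ[K] X, ∀ x y : X,
      σ (deformedMul mp r x y) = deformedMul mp R (σ x) (σ y) := by
  refine exists_congr fun σ => forall₂_congr fun x y => ?_
  simp only [deformedMul, map_add]
  rw [← sub_eq_zero, ← sub_eq_zero (b := σ x * σ y + _ + _)]
  refine Eq.congr ?_ rfl
  abel

theorem IsDeformationMap.graph_mul (hmp : IsCanonicalMatchedPair A X mp)
    {r : X →ₗ[K] A} (hr : IsDeformationMap mp r) (x y : X) :
    ((r x : E) + x) * (r y + y) =
      (r (deformedMul mp r x y) : E) + (deformedMul mp r x y : X) := by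
  rw [hmp.graph_mul, (isDeformationMap_iff r).1 hr]

/-- The subalgebra `{r(x) + x : x ∈ X}` of `E` attached to a deformation map `r`. -/
def deformationGraph (hmp : IsCanonicalMatchedPair A X mp)
    (r : X →ₗ[K] A) (hr : IsDeformationMap mp r) : NonUnitalSubalgebra K E where
  carrier := {e : E | ∃ x : X, e = (r x : E) + (x : E)}
  add_mem' := by
    rintro _ _ ⟨x, rfl⟩ ⟨y, rfl⟩
    exact ⟨x + y, by simp only [map_add, NonUnitalSubalgebra.coe_add]; abel⟩
  zero_mem' := ⟨0, by simp⟩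
  mul_mem' := by
    rintro _ _ ⟨x, rfl⟩ ⟨y, rfl⟩
    exact ⟨deformedMul mp r x y, hr.graph_mul hmp x y⟩
  smul_mem' := by
    rintro c _ ⟨x, rfl⟩
    exact ⟨c • x, by simp only [map_smul, NonUnitalSubalgebra.coe_smul, smul_add]⟩

theorem isComplement_deformationGraph (h : IsComplement A X)
    (hmp : IsCanonicalMatchedPair A X mp) {r : X →ₗ[K] A} (hr : IsDeformationMap mp r) :
    IsComplement A (deformationGraph hmp r hr) := by
  constructor
  · intro e
    obtain ⟨a, ha, x, hx, rfl⟩ := h.1 e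
    refine ⟨a - r ⟨x, hx⟩, sub_mem ha (r ⟨x, hx⟩).2, _, ⟨⟨x, hx⟩, rfl⟩, ?_⟩
    abel
  · rintro _ hA ⟨x, rfl⟩
    have hx : x = 0 :=
      (h.add_inj (a := r x) (b := ⟨_, hA⟩) (x := x) (y := 0) (by simp)).2
    simp [hx]

/-- The linear isomorphism `x ↦ r(x) + x` from `X` to the graph subalgebra. -/
noncomputable def deformationGraphEquiv (h : IsComplement A X)
    (hmp : IsCanonicalMatchedPair A X mp) (r : X →ₗ[K] A) (hr : IsDeformationMap mp r) :
    X ≃ₗ[K] deformationGraph hmp r hr :=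
  LinearEquiv.ofBijective
    { toFun := fun x => (⟨(r x : E) + x, x, rfl⟩ : deformationGraph hmp r hr)
      map_add' := fun x y => Subtype.ext (by
        simp only [map_add, NonUnitalSubalgebra.coe_add]; abel)
      map_smul' := fun c x => Subtype.ext (by
        simp only [map_smul, NonUnitalSubalgebra.coe_smul, smul_add, RingHom.id_apply]) }
    ⟨fun _ _ hxy => (h.add_inj (congrArg Subtype.val hxy)).2,
      fun ⟨_, x, hx⟩ => ⟨x, Subtype.ext hx.symm⟩⟩

theorem deformationGraphEquiv_deformedMul (h : IsComplement A X)
    (hmp : IsCanonicalMatchedPair A X mp) {r : X →ₗ[K] A} (hr : IsDeformationMap mp r) (x y : X) :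
    deformationGraphEquiv h hmp r hr (deformedMul mp r x y) =
      deformationGraphEquiv h hmp r hr x * deformationGraphEquiv h hmp r hr y :=
  Subtype.ext (hr.graph_mul hmp x y).symm

theorem deformationGraph_injective (h : IsComplement A X)
    (hmp : IsCanonicalMatchedPair A X mp) {r R : X →ₗ[K] A} (hr : IsDeformationMap mp r)
    (hR : IsDeformationMap mp R) (hrR : deformationGraph hmp r hr = deformationGraph hmp R hR) :
    r = R := by
  ext1 x
  obtain ⟨y, hy⟩ : (r x : E) + x ∈ deformationGraph hmp R hR := hrR ▸ ⟨x, rfl⟩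
  obtain ⟨h₁, rfl⟩ := h.add_inj hy
  exact h₁

theorem IsComplement.eq_of_add_mem {Y : NonUnitalSubalgebra K E} (hY : IsComplement A Y)
    {a b : A} {e : E} (ha : (a : E) + e ∈ Y) (hb : (b : E) + e ∈ Y) : a = b := by
  refine Subtype.ext (sub_eq_zero.1 (hY.2 _ (sub_mem a.2 b.2) ?_))
  simpa using sub_mem ha hb

/-- Every complement `Y` is met by the coset `A + x` in exactly one point `r(x) + x`, which
depends linearly on `x`. -/
theorem IsComplement.exists_linearMap {Y : NonUnitalSubalgebra K E} (hY : IsComplement A Y) :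
    ∃ r : X →ₗ[K] A, ∀ x : X, (r x : E) + x ∈ Y := by
  have hex : ∀ x : X, ∃ a : A, (a : E) + x ∈ Y := by
    intro x
    obtain ⟨a, ha, y, hy, hxy⟩ := hY.1 x
    exact ⟨-⟨a, ha⟩, by simpa [hxy] using hy⟩
  choose f hf using hex
  refine ⟨{ toFun := f, map_add' := fun x y => ?_, map_smul' := fun c x => ?_ }, hf⟩
  · refine hY.eq_of_add_mem (hf (x + y)) ?_
    convert add_mem (hf x) (hf y) using 1
    simp only [NonUnitalSubalgebra.coe_add]
    abel
  · refine hY.eq_of_add_mem (hf (c • x)) ?_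
    simpa using SMulMemClass.smul_mem c (hf x)

theorem exists_deformationGraph_eq (h : IsComplement A X)
    (hmp : IsCanonicalMatchedPair A X mp) {Y : NonUnitalSubalgebra K E} (hY : IsComplement A Y) :
    ∃ (r : X →ₗ[K] A) (hr : IsDeformationMap mp r), deformationGraph hmp r hr = Y := by
  obtain ⟨r, hrY⟩ := hY.exists_linearMap (X := X)
  have hr : IsDeformationMap mp r := (isDeformationMap_iff r).2 fun x y =>
    hY.eq_of_add_mem (hmp.graph_mul r x y ▸ mul_mem (hrY x) (hrY y)) (hrY _)
  refine ⟨r, hr, SetLike.ext fun e => ⟨?_, fun he => ?_⟩⟩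
  · rintro ⟨x, rfl⟩
    exact hrY x
  · obtain ⟨a, ha, x, hx, rfl⟩ := h.1 e
    have hax : (⟨a, ha⟩ : A) = r ⟨x, hx⟩ := hY.eq_of_add_mem he (hrY ⟨x, hx⟩)
    exact ⟨⟨x, hx⟩, by rw [← hax]⟩

/-- Deformation maps correspond bijectively to complements via their graphs. -/
noncomputable def deformationMapEquivComplement (h : IsComplement A X)
    (hmp : IsCanonicalMatchedPair A X mp) :
    {r : X →ₗ[K] A // IsDeformationMap mp r} ≃
      {Y : NonUnitalSubalgebra K E // IsComplement A Y} :=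
  Equiv.ofBijective
    (fun r => ⟨deformationGraph hmp r.1 r.2, isComplement_deformationGraph h hmp r.2⟩)
    ⟨fun r R hrR => Subtype.ext
        (deformationGraph_injective h hmp r.2 R.2 (congrArg Subtype.val hrR)),
      fun Y => by
        obtain ⟨r, hr, hrY⟩ := exists_deformationGraph_eq h hmp Y.2
        exact ⟨⟨r, hr⟩, Subtype.ext hrY⟩⟩

theorem defMapEquiv_iff_deformationGraph (h : IsComplement A X)
    (hmp : IsCanonicalMatchedPair A X mp) {r R : X →ₗ[K] A} (hr : IsDeformationMap mp r)
    (hR : IsDeformationMap mp R) :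
    DefMapEquiv mp r R ↔
      ∃ f : deformationGraph hmp r hr ≃ₗ[K] deformationGraph hmp R hR,
        ∀ u v, (f (u * v) : E) = (f u : E) * (f v : E) := by
  rw [defMapEquiv_iff]
  set e := deformationGraphEquiv h hmp r hr
  set e' := deformationGraphEquiv h hmp R hR
  constructor
  · rintro ⟨σ, hσ⟩
    refine ⟨e.symm.trans (σ.trans e'), fun u v => ?_⟩
    obtain ⟨x, rfl⟩ := e.surjective u
    obtain ⟨y, rfl⟩ := e.surjective v
    rw [← deformationGraphEquiv_deformedMul]
    simp only [LinearEquiv.trans_apply]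
    simp only [e, LinearEquiv.symm_apply_apply, hσ]
    exact congrArg Subtype.val (deformationGraphEquiv_deformedMul h hmp hR _ _)
  · rintro ⟨f, hf⟩
    refine ⟨e.trans (f.trans e'.symm), fun x y => e'.injective ?_⟩
    rw [deformationGraphEquiv_deformedMul]
    simp only [LinearEquiv.trans_apply, e', LinearEquiv.apply_symm_apply]
    simp only [e, deformationGraphEquiv_deformedMul]
    exact Subtype.ext (hf _ _)

end Complements

/-- Let `A` be a subalgebra of `E`, `X` an `A`-complement of `E` and
`(A, X, ▷, ◁, ↼, ⇀)` the associated canonical matched pair.  The assignment `r ↦ X_r`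
induces a bijection between the quotient of the set of deformation maps by the
equivalence relation `∼` and the set of algebra-isomorphism classes of `A`-complements
of `E`; concretely, the class of `r` is sent to the isomorphism class of the
`A`-complement of `E` with underlying set `{r(x) + x : x ∈ X}`, which is isomorphic to
`X_r`.  In particular the factorization index `[E : A]^f` equals the number of
equivalence classes of deformation maps. -/
theorem complements_classified {K E : Type*} [Field K]
    [NonUnitalRing E] [Module K E] [SMulCommClass K E E] [IsScalarTower K E E]
    (A X : NonUnitalSubalgebra K E) (h : IsComplement A X)
    (mp : MatchedPair K A X) (hmp : IsCanonicalMatchedPair A X mp) :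
    ∃ F : Quot (fun r R : {r : X →ₗ[K] A // IsDeformationMap mp r} =>
          DefMapEquiv mp r.1 R.1) ≃
        Quot (fun Y Z : {Y : NonUnitalSubalgebra K E // IsComplement A Y} =>
          ∃ f : Y.1 ≃ₗ[K] Z.1, ∀ u v : Y.1, (f (u * v) : E) = (f u : E) * (f v : E)),
      ∀ r : {r : X →ₗ[K] A // IsDeformationMap mp r},
        ∃ Y : {Y : NonUnitalSubalgebra K E // IsComplement A Y},
          F (Quot.mk _ r) = Quot.mk _ Y ∧
          (Y.1 : Set E) = {e : E | ∃ x : X, e = (r.1 x : E) + (x : E)} ∧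
          ∃ f : X ≃ₗ[K] Y.1, ∀ x y : X,
            (f (deformedMul mp r.1 x y) : E) = (f x : E) * (f y : E) := by
  refine ⟨Quot.congr (deformationMapEquivComplement h hmp) fun r R =>
    defMapEquiv_iff_deformationGraph h hmp r.2 R.2, fun r => ?_⟩
  exact ⟨deformationMapEquivComplement h hmp r, rfl, rfl, deformationGraphEquiv h hmp r.1 r.2,
    fun x y => congrArg Subtype.val (deformationGraphEquiv_deformedMul h hmp r.2 x y)⟩
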